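/- arXiv:1106.0399 — 2 statements merged into one kernel-verified Lean document; each statement's English description precedes it below -/
import Mathlib

section
/- In LG_I the following inequalities are derivable for all formulas A, B, C: A⊗(B⊕C) ≤ (A⊗B)⊕C, (A⊕B)⊗C ≤ A⊕(B⊗C), A⊗(B⊕C) ≤ B⊕(A⊗C), and (A⊕B)⊗C ≤ (A⊗C)⊕B. -/
/-- Unpolarized formulas of LG/CNL.  `ldiv B A` denotes `B\A`, `lsub B A` denotes `B⦸A`,
`rdiv A B` denotes `A/B`, `rsub A B` denotes `A⊘B`. -/
inductive Fm : Type
  | pos : Nat → Fm                -- positive atom p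
  | neg : Nat → Fm                -- negative atom p̄
  | tens : Fm → Fm → Fm           -- A ⊗ B
  | par : Fm → Fm → Fm            -- A ⊕ B
  | rdiv : Fm → Fm → Fm           -- A / B
  | ldiv : Fm → Fm → Fm           -- B \ A  (ldiv B A)
  | rsub : Fm → Fm → Fm           -- A ⊘ B
  | lsub : Fm → Fm → Fm           -- B ⦸ A  (lsub B A)
  | conj : Fm → Fm → Fm           -- A ∧ B
  | disj : Fm → Fm → Fm           -- A ∨ B

/-- Linear negation. -/
def Fm.dual : Fm → Fm
  | .pos n => .neg n
  | .neg n => .pos n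
  | .tens A B => .par B.dual A.dual        -- (A⊗B)⊥ = B⊥⊕A⊥
  | .par A B => .tens B.dual A.dual        -- (A⊕B)⊥ = B⊥⊗A⊥
  | .rdiv A B => .lsub B.dual A.dual       -- (A/B)⊥ = B⊥⦸A⊥
  | .lsub B A => .rdiv A.dual B.dual       -- (B⦸A)⊥ = A⊥/B⊥
  | .ldiv B A => .rsub A.dual B.dual       -- (B\A)⊥ = A⊥⊘B⊥
  | .rsub A B => .ldiv B.dual A.dual       -- (A⊘B)⊥ = B⊥\A⊥
  | .conj A B => .disj B.dual A.dual       -- (A∧B)⊥ = B⊥∨A⊥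
  | .disj A B => .conj B.dual A.dual       -- (A∨B)⊥ = B⊥∧A⊥
/-- Algebraic derivability `Le I A B` (`A ≤ B`).  The Boolean index `I` tells whether the
Grishin linear distributivity rules of LG_I are available: `Le false` is LG∅, `Le true` is LG_I. -/
inductive Le : Bool → Fm → Fm → Prop
  | refl (I : Bool) (A : Fm) : Le I A A
  | trans {I A B C} : Le I A B → Le I B C → Le I A C
  -- residuation: A⊗B ≤ C iff A ≤ C/B iff B ≤ A\C
  | res_div {I A B C} : Le I (.tens A B) C → Le I A (.rdiv C B)
  | res_div' {I A B C} : Le I A (.rdiv C B) → Le I (.tens A B) C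
  | res_ldiv {I A B C} : Le I (.tens A B) C → Le I B (.ldiv A C)
  | res_ldiv' {I A B C} : Le I B (.ldiv A C) → Le I (.tens A B) C
  -- coresiduation: C ≤ A⊕B iff A⦸C ≤ B iff C⊘B ≤ A
  | cores_lsub {I A B C} : Le I C (.par A B) → Le I (.lsub A C) B
  | cores_lsub' {I A B C} : Le I (.lsub A C) B → Le I C (.par A B)
  | cores_rsub {I A B C} : Le I C (.par A B) → Le I (.rsub C B) A
  | cores_rsub' {I A B C} : Le I (.rsub C B) A → Le I C (.par A B)
  -- meets: A ≤ B∧C iff A ≤ B and A ≤ C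
  | meet_intro {I A B C} : Le I A B → Le I A C → Le I A (.conj B C)
  | meet_left {I A B C} : Le I A (.conj B C) → Le I A B
  | meet_right {I A B C} : Le I A (.conj B C) → Le I A C
  -- joins: A∨B ≤ C iff A ≤ C and B ≤ C
  | join_intro {I A B C} : Le I A C → Le I B C → Le I (.disj A B) C
  | join_left {I A B C} : Le I (.disj A B) C → Le I A C
  | join_right {I A B C} : Le I (.disj A B) C → Le I B C
  -- Grishin linear distributivity (only in LG_I)
  | gr1 {A B C D} : Le true (.rsub A B) (.ldiv C D) → Le true (.tens C A) (.par D B)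
  | gr2 {A B C D} : Le true (.lsub A B) (.rdiv C D) → Le true (.tens B D) (.par A C)
  | gr3 {A B C D} : Le true (.lsub A B) (.ldiv C D) → Le true (.tens C B) (.par A D)
  | gr4 {A B C D} : Le true (.rsub A B) (.rdiv C D) → Le true (.tens A D) (.par C B)

/-- Lemma 2.3: linear distributivity inequalities derivable in LG_I. -/
theorem linear_distributivity (A B C : Fm) :
    Le true (.tens A (.par B C)) (.par (.tens A B) C) ∧
    Le true (.tens (.par A B) C) (.par A (.tens B C)) ∧
    Le true (.tens A (.par B C)) (.par B (.tens A C)) ∧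
    Le true (.tens (.par A B) C) (.par (.tens A C) B) := by
  refine ⟨.gr1 ?_, .gr2 ?_, .gr3 ?_, .gr4 ?_⟩
  · exact .trans (.cores_rsub (.refl _ _)) (.res_ldiv (.refl _ _))
  · exact .trans (.cores_lsub (.refl _ _)) (.res_div (.refl _ _))
  · exact .trans (.cores_lsub (.refl _ _)) (.res_ldiv (.refl _ _))
  · exact .trans (.cores_rsub (.refl _ _)) (.res_div (.refl _ _))
end

section
/- For all formulas A, B: A ≤ B in LG∅ if and only if B⊥ ≤ A⊥ in LG∅; and likewise A ≤ B in LG_I if and only if B⊥ ≤ A⊥ in LG_I. -/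
theorem Fm.dual_dual (A : Fm) : A.dual.dual = A := by
  induction A <;> simp_all [Fm.dual]

theorem Le.dualize {I : Bool} {A B : Fm} (h : Le I A B) : Le I B.dual A.dual := by
  induction h with
  | refl I A => exact .refl _ _
  | trans _ _ h1 h2 => exact .trans h2 h1
  | res_div _ h => exact .cores_lsub h
  | res_div' _ h => exact .cores_lsub' h
  | res_ldiv _ h => exact .cores_rsub h
  | res_ldiv' _ h => exact .cores_rsub' h
  | cores_lsub _ h => exact .res_div h
  | cores_lsub' _ h => exact .res_div' h
  | cores_rsub _ h => exact .res_ldiv h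
  | cores_rsub' _ h => exact .res_ldiv' h
  | meet_intro _ _ h1 h2 => exact .join_intro h2 h1
  | meet_left _ h => exact .join_right h
  | meet_right _ h => exact .join_left h
  | join_intro _ _ h1 h2 => exact .meet_intro h2 h1
  | join_left _ h => exact .meet_right h
  | join_right _ h => exact .meet_left h
  | gr1 _ h => exact .gr1 h
  | gr2 _ h => exact .gr2 h
  | gr3 _ h => exact .gr4 h
  | gr4 _ h => exact .gr3 h

/-- Lemma 2.7: A ≤ B iff B⊥ ≤ A⊥, both in LG∅ (`I = false`) and
in LG_I (`I = true`). -/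
theorem le_dual_iff (I : Bool) (A B : Fm) : Le I A B ↔ Le I B.dual A.dual := by
  refine ⟨Le.dualize, fun h => ?_⟩
  have h2 := h.dualize
  rwa [Fm.dual_dual, Fm.dual_dual] at h2
end
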